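/- arXiv:2305.11361 — 5 statements merged into one kernel-verified Lean document; each statement's English description precedes it below -/
import Mathlib

section
/- Let n ≥ 1, let α be a real number with α ≠ 0 and α ≠ 1, let y ∈ ℝ^n have strictly positive entries with mean μ = (1/n) Σ_{i=1}^n y_i, and let K ∈ ℝ^{n×n} have nonnegative entries, strictly positive row sums, and columns summing to one (Σ_{i=1}^n K_{ij} = 1 for every j). Then the generalized entropy index admits the generalized additive decomposition F_α(y) = Σ_{i=1}^n [ (A(K,y)_i)^α · (Σ_{j} K_{ij}) / (μ^α · n) ] · F_α(y, K_{i·}) + F_α(A(K,y), K𝟙), where K_{i·} denotes the i-th row of K used as a weight vector and K𝟙 ∈ ℝ^n is the vector of row sums of K. -/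
open Finset

/-- Averaging operator: `A(K,y)_i = (∑_j K_{ij} y_j) / (∑_j K_{ij})`. -/
noncomputable def avg {n : ℕ} (K : Fin n → Fin n → ℝ) (y : Fin n → ℝ) : Fin n → ℝ :=
  fun i => (∑ j, K i j * y j) / (∑ j, K i j)

/-- Generalized entropy index `F_α(y)` with mean `μ = (∑_i y_i)/n`. -/
noncomputable def genEntropy {n : ℕ} (α : ℝ) (y : Fin n → ℝ) : ℝ :=
  (1 / ((n : ℝ) * α * (α - 1))) * ∑ i, ((y i / ((∑ i', y i') / (n : ℝ))) ^ α - 1)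

/-- Weighted generalized entropy index `F_α(y, w)` with weighted mean
`μ_w = (∑_i w_i y_i)/(∑_i w_i)`. -/
noncomputable def wGenEntropy {n : ℕ} (α : ℝ) (y w : Fin n → ℝ) : ℝ :=
  (1 / (α * (α - 1))) *
    ∑ i, (w i / ∑ i', w i') *
      ((y i / ((∑ i', w i' * y i') / (∑ i', w i'))) ^ α - 1)

/-- **Generalized additive decomposability.** For a column-normalized nonnegative kernel `K`
with positive row sums and a strictly positive outcome vector `y`, the generalized entropy
decomposes as `F_α(y) = ∑_i [(A(K,y)_i)^α (∑_j K_{ij}) / (μ^α n)] F_α(y, K_{i·})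
+ F_α(A(K,y), K𝟙)`. -/
theorem generalized_additive_decomposability {n : ℕ} (hn : 1 ≤ n)
    (α : ℝ) (hα0 : α ≠ 0) (hα1 : α ≠ 1)
    (y : Fin n → ℝ) (hy : ∀ i, 0 < y i)
    (K : Fin n → Fin n → ℝ) (hK : ∀ i j, 0 ≤ K i j)
    (hrow : ∀ i, 0 < ∑ j, K i j)
    (hcol : ∀ j, ∑ i, K i j = 1) :
    genEntropy α y =
      (∑ i, ((avg K y i) ^ α * (∑ j, K i j) / (((∑ i', y i') / (n : ℝ)) ^ α * (n : ℝ))) *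
          wGenEntropy α y (K i)) +
        wGenEntropy α (avg K y) (fun i => ∑ j, K i j) := by
  have hn0 : (0 : ℝ) < n := by exact_mod_cast hn
  have hne : (Finset.univ : Finset (Fin n)).Nonempty := ⟨⟨0, hn⟩, Finset.mem_univ _⟩
  have hα1' : α - 1 ≠ 0 := sub_ne_zero.mpr hα1
  have hS : 0 < ∑ i, y i := Finset.sum_pos (fun i _ => hy i) hne
  have hμ : 0 < (∑ i, y i) / (n : ℝ) := div_pos hS hn0
  have hrs : ∑ i, ∑ j, K i j = (n : ℝ) := by
    rw [Finset.sum_comm]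
    simp [hcol]
  have hKy : ∀ i, 0 < ∑ j, K i j * y j := by
    intro i
    have h0 : ∀ j ∈ (Finset.univ : Finset (Fin n)), 0 ≤ K i j * y j :=
      fun j _ => mul_nonneg (hK i j) (hy j).le
    refine lt_of_le_of_ne (Finset.sum_nonneg h0) ?_
    intro h
    have h1 := (Finset.sum_eq_zero_iff_of_nonneg h0).mp h.symm
    have h2 : ∑ j, K i j = 0 := Finset.sum_eq_zero (fun j hj => by
      rcases mul_eq_zero.mp (h1 j hj) with h | h
      · exact h
      · exact absurd h (hy j).ne')
    exact absurd h2 (hrow i).ne'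
  have ha : ∀ i, 0 < avg K y i := fun i => div_pos (hKy i) (hrow i)
  have hra : ∑ i, (∑ j, K i j) * avg K y i = ∑ j, y j := by
    have : ∀ i, (∑ j, K i j) * avg K y i = ∑ j, K i j * y j := by
      intro i
      unfold avg
      exact mul_div_cancel₀ _ (hrow i).ne'
    simp only [this]
    rw [Finset.sum_comm]
    simp [← Finset.sum_mul, hcol]
  set μ : ℝ := (∑ i, y i) / (n : ℝ) with hμdef
  have hμα : 0 < μ ^ α := Real.rpow_pos_of_pos hμ α
  have e1 : genEntropy α y =
      1 / (α * (α - 1)) / (μ ^ α * n) * (∑ j, y j ^ α) - 1 / (α * (α - 1)) := by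
    unfold genEntropy
    rw [← hμdef]
    have : ∀ i, (y i / μ) ^ α = y i ^ α / μ ^ α := fun i => Real.div_rpow (hy i).le hμ.le α
    simp only [this, Finset.sum_sub_distrib, ← Finset.sum_div]
    simp only [Finset.sum_const, Finset.card_univ, Fintype.card_fin, nsmul_eq_mul, mul_one]
    field_simp
  have e2 : wGenEntropy α (avg K y) (fun i => ∑ j, K i j) =
      1 / (α * (α - 1)) / (μ ^ α * n) * (∑ i, (∑ j, K i j) * avg K y i ^ α)
        - 1 / (α * (α - 1)) := by
    unfold wGenEntropy
    simp only [hra, hrs]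
    rw [← hμdef]
    have : ∀ i, (∑ j, K i j) / (n : ℝ) * ((avg K y i / μ) ^ α - 1) =
        (∑ j, K i j) * avg K y i ^ α / (μ ^ α * n) - (∑ j, K i j) / n := by
      intro i
      rw [Real.div_rpow (ha i).le hμ.le α]
      field_simp
    simp only [this, Finset.sum_sub_distrib, ← Finset.sum_div, hrs]
    field_simp
  have e3 : ∀ i, (avg K y i ^ α * (∑ j, K i j) / (μ ^ α * (n : ℝ))) * wGenEntropy α y (K i) =
      1 / (α * (α - 1)) / (μ ^ α * n) *
        ((∑ j, K i j * y j ^ α) - (∑ j, K i j) * avg K y i ^ α) := by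
    intro i
    have hd : (∑ j, K i j * y j) / (∑ j, K i j) = avg K y i := rfl
    have haα : 0 < avg K y i ^ α := Real.rpow_pos_of_pos (ha i) α
    have hr := hrow i
    unfold wGenEntropy
    rw [hd]
    have : ∀ j, K i j / (∑ j, K i j) * ((y j / avg K y i) ^ α - 1) =
        K i j * y j ^ α / ((∑ j, K i j) * avg K y i ^ α) - K i j / (∑ j, K i j) := by
      intro j
      rw [Real.div_rpow (hy j).le (ha i).le α]
      field_simp
    simp only [this, Finset.sum_sub_distrib, ← Finset.sum_div]
    field_simp
  have e4 : ∑ i, ∑ j, K i j * y j ^ α = ∑ j, y j ^ α := by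
    rw [Finset.sum_comm]
    simp [← Finset.sum_mul, hcol]
  rw [e1, e2, Finset.sum_congr rfl (fun i _ => e3 i), ← Finset.mul_sum,
    Finset.sum_sub_distrib, e4]
  ring
end

section
/- Let α be a real number with α ∉ {0,1}, let y ∈ ℝ^n have strictly positive entries with mean μ, and let 𝒢 be a partition of {1,…,n}. For each g ∈ 𝒢 write n_g = |g|, μ_g = (1/n_g) Σ_{i∈g} y_i, y_g for the restriction of y to the indices in g, and let x̄ ∈ ℝ^n be defined by x̄_i = μ_{g(i)} where g(i) is the group containing i. Then: (a) F_α(y) = Σ_{g∈𝒢} (μ_g^α · n_g)/(μ^α · n) · F_α(y_g) + F_α(x̄); and (b) the group-free between-group inequality computed with the ground-truth kernel K* equals the classical between-group inequality, i.e., A(K*,y)_i = μ_{g(i)} for every i, every row sum of K* equals 1, and F_α(A(K*,y), K*𝟙) = F_α(x̄). -/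
open Finset

/-- Generalized entropy index of the restriction of `y` to a subpopulation `s`. -/
noncomputable def genEntropyOn {n : ℕ} (α : ℝ) (y : Fin n → ℝ) (s : Finset (Fin n)) : ℝ :=
  (1 / ((s.card : ℝ) * α * (α - 1))) *
    ∑ i ∈ s, ((y i / ((∑ i' ∈ s, y i') / (s.card : ℝ))) ^ α - 1)

/-- The group (fiber) of label `c` for the group labeling `g`. -/
def fiber {n m : ℕ} (g : Fin n → Fin m) (c : Fin m) : Finset (Fin n) :=
  Finset.univ.filter (fun i => g i = c)

/-- The mean outcome `μ_g` within group `c`. -/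
noncomputable def groupMean {n m : ℕ} (g : Fin n → Fin m) (y : Fin n → ℝ) (c : Fin m) : ℝ :=
  (∑ i ∈ fiber g c, y i) / ((fiber g c).card : ℝ)

/-- The ground-truth kernel `K*` of the partition into fibers of `g`:
`K*_{ij} = 1/|g(i)|` if `i, j` are in the same group, and `0` otherwise. -/
noncomputable def gtKernel {n m : ℕ} (g : Fin n → Fin m) : Fin n → Fin n → ℝ :=
  fun i j => if g i = g j then 1 / ((fiber g (g i)).card : ℝ) else 0

lemma sum_fiber_aux {n m : ℕ} (g : Fin n → Fin m) (f : Fin n → ℝ) :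
    ∑ c, ∑ i ∈ fiber g c, f i = ∑ i, f i := by
  unfold fiber
  exact Finset.sum_fiberwise _ _ _

lemma sum_gtKernel_aux {n m : ℕ} (g : Fin n → Fin m) (f : Fin n → ℝ) (i : Fin n) :
    ∑ j, gtKernel g i j * f j = (∑ j ∈ fiber g (g i), f j) / ((fiber g (g i)).card : ℝ) := by
  have h : ∀ j, gtKernel g i j * f j =
      if g j = g i then f j / ((fiber g (g i)).card : ℝ) else 0 := by
    intro j
    unfold gtKernel
    by_cases h : g i = g j
    · rw [if_pos h, if_pos h.symm]; ring
    · rw [if_neg h, if_neg (fun h' => h h'.symm)]; ring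
  rw [Finset.sum_congr rfl (fun j _ => h j), ← Finset.sum_filter, ← Finset.sum_div]
  rfl

/-- **Classical additive decomposability and the ground-truth kernel.**
(a) `F_α(y) = ∑_g (μ_g^α n_g)/(μ^α n) F_α(y_g) + F_α(x̄)` where `x̄_i = μ_{g(i)}`;
(b) the group-free between-group inequality computed with the ground-truth kernel `K*`
equals the classical between-group inequality: `A(K*,y)_i = μ_{g(i)}`, the row sums of `K*`
all equal `1`, and `F_α(A(K*,y), K*𝟙) = F_α(x̄)`. -/
theorem classical_decomposition_and_ground_truth_kernel {n m : ℕ}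
    (α : ℝ) (hα0 : α ≠ 0) (hα1 : α ≠ 1)
    (y : Fin n → ℝ) (hy : ∀ i, 0 < y i)
    (g : Fin n → Fin m)
    (hne : ∀ c : Fin m, (fiber g c).Nonempty) :
    (genEntropy α y =
        (∑ c : Fin m,
          ((groupMean g y c) ^ α * ((fiber g c).card : ℝ)) /
              (((∑ i, y i) / (n : ℝ)) ^ α * (n : ℝ)) *
            genEntropyOn α y (fiber g c)) +
          genEntropy α (fun i => groupMean g y (g i)))
    ∧ (∀ i, avg (gtKernel g) y i = groupMean g y (g i))
    ∧ (∀ i, ∑ j, gtKernel g i j = 1)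
    ∧ wGenEntropy α (avg (gtKernel g) y) (fun i => ∑ j, gtKernel g i j) =
        genEntropy α (fun i => groupMean g y (g i)) := by
  have hk : ∀ c, ((fiber g c).card : ℝ) ≠ 0 := fun c => by
    exact_mod_cast (Finset.card_pos.mpr (hne c)).ne'
  have hrow : ∀ i, ∑ j, gtKernel g i j = 1 := by
    intro i
    have h := sum_gtKernel_aux g (fun _ => 1) i
    simp only [mul_one, Finset.sum_const, nsmul_eq_mul] at h
    rw [h, div_self (hk _)]
  have havg : ∀ i, avg (gtKernel g) y i = groupMean g y (g i) := by
    intro i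
    unfold avg groupMean
    rw [hrow, div_one, sum_gtKernel_aux]
  have hM : ∀ c, 0 < groupMean g y c := fun c =>
    div_pos (Finset.sum_pos (fun i _ => hy i) (hne c))
      (by exact_mod_cast Finset.card_pos.mpr (hne c))
  have hg : ∀ c, ∀ i ∈ fiber g c, g i = c := by
    intro c i hi
    simpa [fiber] using hi
  have hmean : ∑ i, groupMean g y (g i) = ∑ i, y i := by
    rw [← sum_fiber_aux g, ← sum_fiber_aux g y]
    refine Finset.sum_congr rfl fun c _ => ?_
    rw [Finset.sum_congr rfl (fun i hi => by rw [hg c i hi]), Finset.sum_const, nsmul_eq_mul]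
    unfold groupMean
    rw [mul_div_cancel₀ _ (hk c)]
  refine ⟨?_, havg, hrow, ?_⟩
  · unfold genEntropy
    rw [hmean]
    rcases Nat.eq_zero_or_pos n with h0 | hn
    · subst h0
      simp
    have hn' : (0 : ℝ) < n := by exact_mod_cast hn
    have hμ : 0 < (∑ i, y i) / (n : ℝ) :=
      div_pos (Finset.sum_pos (fun i _ => hy i) ⟨⟨0, hn⟩, Finset.mem_univ _⟩) hn'
    generalize (∑ i, y i) / (n : ℝ) = μ at hμ
    have hα1' : α - 1 ≠ 0 := sub_ne_zero.mpr hα1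
    have hterm : ∀ c, ((groupMean g y c) ^ α * ((fiber g c).card : ℝ)) / (μ ^ α * (n : ℝ)) *
        genEntropyOn α y (fiber g c) = (1 / ((n : ℝ) * α * (α - 1))) *
          ∑ i ∈ fiber g c, ((y i / μ) ^ α - (groupMean g y (g i) / μ) ^ α) := by
      intro c
      have hMα := (Real.rpow_pos_of_pos (hM c) α).ne'
      have hμα := (Real.rpow_pos_of_pos hμ α).ne'
      have e : ∑ i ∈ fiber g c, ((y i / μ) ^ α - (groupMean g y (g i) / μ) ^ α) =
          (groupMean g y c) ^ α / μ ^ α *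
            ∑ i ∈ fiber g c, ((y i / groupMean g y c) ^ α - 1) := by
        rw [Finset.mul_sum]
        refine Finset.sum_congr rfl fun i hi => ?_
        rw [hg c i hi, Real.div_rpow (hy i).le hμ.le, Real.div_rpow (hM c).le hμ.le,
          Real.div_rpow (hy i).le (hM c).le]
        field_simp
      rw [e]
      change _ * ((1 / (((fiber g c).card : ℝ) * α * (α - 1))) *
        ∑ i ∈ fiber g c, ((y i / groupMean g y c) ^ α - 1)) = _
      have := hk c
      field_simp
    rw [Finset.sum_congr rfl (fun c _ => hterm c), ← Finset.mul_sum, sum_fiber_aux, ← mul_add,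
      ← Finset.sum_add_distrib]
    congr 1
    refine Finset.sum_congr rfl fun i _ => ?_
    ring
  · have e1 : avg (gtKernel g) y = fun i => groupMean g y (g i) := funext havg
    have e2 : (fun i => ∑ j, gtKernel g i j) = fun _ => (1 : ℝ) := funext hrow
    rw [e1, e2]
    unfold wGenEntropy genEntropy
    simp only [one_mul, Finset.sum_const, Finset.card_univ, Fintype.card_fin, nsmul_eq_mul,
      mul_one]
    rw [← Finset.mul_sum, ← mul_assoc]
    congr 1
    rw [div_mul_div_comm]
    congr 1 <;> ring
end

section
/- Let the population {1,…,2n} (n ≥ 1) be partitioned into V₁ = {1,…,n} and V₂ = {n+1,…,2n}, and let y ∈ ℝ^{2n} have nonnegative entries with group means μ₁ = (1/n) Σ_{i∈V₁} y_i and μ₂ = (1/n) Σ_{i∈V₂} y_i satisfying μ₁ + μ₂ > 0. Let 0 ≤ q < p, and define the blended kernel K ∈ ℝ^{2n×2n} by K_{ij} = p if i,j lie in the same part (both in V₁ or both in V₂) and K_{ij} = q otherwise. Then the normalized variance of the smoothed outcomes satisfies F(A(K,y)) = ((p − q)/(p + q))² · ((μ₁ − μ₂)/(μ₁ + μ₂))²;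 that is, the between-group inequality with the blending similarity equals ((p−q)/(p+q))² times the ground-truth between-group inequality F(x̄), where x̄_i = μ₁ for i ∈ V₁ and x̄_i = μ₂ for i ∈ V₂. -/
open Finset

/-- Normalized variance inequality index:
`F(y) = (1/(n μ²)) ∑_i (y_i − μ)²` where `μ = (∑_i y_i)/n`. -/
noncomputable def normVar {n : ℕ} (y : Fin n → ℝ) : ℝ :=
  (1 / ((n : ℝ) * ((∑ i, y i) / (n : ℝ)) ^ 2)) *
    ∑ i, (y i - (∑ i', y i') / (n : ℝ)) ^ 2

theorem sum_step (n : ℕ) (a b : ℝ) :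
    ∑ i : Fin (2 * n), (if (i : ℕ) < n then a else b) = n * a + n * b := by
  rw [Fin.sum_univ_eq_sum_range (fun i => if i < n then a else b) (2 * n), two_mul,
    Finset.sum_range_add]
  congr 1
  · rw [Finset.sum_congr rfl (g := fun _ => a)]
    · simp
    · intro i hi
      simp [Finset.mem_range.1 hi]
  · simp

theorem normVar_step {n : ℕ} (hn : 1 ≤ n) (a b : ℝ) (hab : 0 < a + b) :
    normVar (fun i : Fin (2 * n) => if (i : ℕ) < n then a else b)
      = ((a - b) / (a + b)) ^ 2 := by
  have hn' : (n : ℝ) ≠ 0 := by positivity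
  have hab' := hab.ne'
  unfold normVar
  rw [sum_step]
  have hm : ((n : ℝ) * a + n * b) / ((2 * n : ℕ) : ℝ) = (a + b) / 2 := by
    push_cast
    field_simp
  rw [hm]
  have h2 : ∀ i : Fin (2 * n), ((if (i : ℕ) < n then a else b) - (a + b) / 2) ^ 2
      = ((a - b) / 2) ^ 2 := by
    intro i
    split_ifs <;> ring
  simp only [h2, Finset.sum_const, Finset.card_univ, Fintype.card_fin, nsmul_eq_mul]
  push_cast
  field_simp

/-- **Blending lemma.** With the population `{1,…,2n}` split into `V₁` (indices `< n`) and
`V₂` (indices `≥ n`), group means `μ₁, μ₂` with `μ₁ + μ₂ > 0`, and the blended kernel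
`K_{ij} = p` for `i, j` in the same part and `K_{ij} = q` otherwise (`0 ≤ q < p`), the
normalized variance of the smoothed outcomes satisfies
`F(A(K,y)) = ((p − q)/(p + q))² ((μ₁ − μ₂)/(μ₁ + μ₂))² = ((p − q)/(p + q))² F(x̄)`,
where `x̄_i = μ₁` on `V₁` and `x̄_i = μ₂` on `V₂`. -/
theorem blending_similarity {n : ℕ} (hn : 1 ≤ n)
    (y : Fin (2 * n) → ℝ) (hy : ∀ i, 0 ≤ y i)
    (p q : ℝ) (hq : 0 ≤ q) (hqp : q < p)
    (K : Fin (2 * n) → Fin (2 * n) → ℝ)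
    (hK : ∀ i j, K i j = if ((i : ℕ) < n ↔ (j : ℕ) < n) then p else q)
    (μ₁ μ₂ : ℝ)
    (hμ₁ : μ₁ = (∑ i : Fin (2 * n), if (i : ℕ) < n then y i else 0) / (n : ℝ))
    (hμ₂ : μ₂ = (∑ i : Fin (2 * n), if (i : ℕ) < n then 0 else y i) / (n : ℝ))
    (hμ : 0 < μ₁ + μ₂) :
    normVar (avg K y) = ((p - q) / (p + q)) ^ 2 * ((μ₁ - μ₂) / (μ₁ + μ₂)) ^ 2 ∧
      normVar (avg K y) =
        ((p - q) / (p + q)) ^ 2 *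
          normVar (fun i : Fin (2 * n) => if (i : ℕ) < n then μ₁ else μ₂) := by
  have hn' : (n : ℝ) ≠ 0 := by positivity
  have hpq : 0 < p + q := by linarith
  have hpq' := hpq.ne'
  have hA : avg K y = fun i : Fin (2 * n) => if (i : ℕ) < n
      then (p * μ₁ + q * μ₂) / (p + q) else (q * μ₁ + p * μ₂) / (p + q) := by
    funext i
    have e1 : (∑ i : Fin (2 * n), if (i : ℕ) < n then y i else 0) = n * μ₁ := by
      rw [hμ₁]; field_simp
    have e2 : (∑ i : Fin (2 * n), if (i : ℕ) < n then 0 else y i) = n * μ₂ := by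
      rw [hμ₂]; field_simp
    have key : ∀ c d : ℝ, (∑ j : Fin (2 * n), (if (j : ℕ) < n then c else d) * y j)
        = c * (n * μ₁) + d * (n * μ₂) := by
      intro c d
      rw [← e1, ← e2, Finset.mul_sum, Finset.mul_sum, ← Finset.sum_add_distrib]
      refine Finset.sum_congr rfl fun j _ => ?_
      split_ifs <;> ring
    unfold avg
    by_cases hi : (i : ℕ) < n
    · have hK' : ∀ j, K i j = if (j : ℕ) < n then p else q := by
        intro j; rw [hK]; simp [hi]
      simp only [hK', key, sum_step, hi, if_true]
      rw [← mul_add]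
      field_simp
    · have hK' : ∀ j, K i j = if (j : ℕ) < n then q else p := by
        intro j; rw [hK]; by_cases hj : (j : ℕ) < n <;> simp [hi, hj]
      simp only [hK', key, sum_step, hi, if_false]
      rw [← mul_add, add_comm q p]
      field_simp
  have hs : (p * μ₁ + q * μ₂) / (p + q) + (q * μ₁ + p * μ₂) / (p + q) = μ₁ + μ₂ := by
    field_simp
    ring
  have hd : (p * μ₁ + q * μ₂) / (p + q) - (q * μ₁ + p * μ₂) / (p + q)
      = (p - q) / (p + q) * (μ₁ - μ₂) := by
    field_simp
    ring
  have h1 : normVar (avg K y) = ((p - q) / (p + q)) ^ 2 * ((μ₁ - μ₂) / (μ₁ + μ₂)) ^ 2 := by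
    rw [hA, normVar_step hn _ _ (by rw [hs]; exact hμ), hs, hd, mul_div_assoc, mul_pow]
  exact ⟨h1, by rw [h1, normVar_step hn _ _ hμ]⟩
end

section
/- Let n ≥ 2 be even, let the population {1,…,n} be partitioned into two sensitive groups G₁ and G₂ each of size n/2, and let y ∈ {0,1}^n satisfy Σ_{i=1}^n y_i = n/2 with Σ_{i∈G₁} y_i = (n/2)(1/2+ε) and Σ_{i∈G₂} y_i = (n/2)(1/2−ε) for some ε ∈ [0,1/2]. Let p > 0, q > 0, define K_s(i,j) = p if i and j are in the same sensitive group and 0 otherwise, and define the label-aligned confounding kernel K_C(i,j) = q if y_i = y_j and 0 otherwise. Set K = K_s + K_C. Then every row sum of K equals n(p+q)/2, and the group-free between-group inequality attains the upper bound: F(A(K,y), K𝟙) = 4ε² + (q/(p+q))²·(1 − 4ε²). -/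
open Finset

/-- Weighted normalized variance
`F(y, w) = (1/μ_w²) ∑_i (w_i / ∑_{i'} w_{i'}) (y_i − μ_w)²` with weighted mean
`μ_w = (∑_i w_i y_i)/(∑_i w_i)`. -/
noncomputable def wNormVar {n : ℕ} (y w : Fin n → ℝ) : ℝ :=
  (1 / ((∑ i, w i * y i) / (∑ i, w i)) ^ 2) *
    ∑ i, (w i / ∑ i', w i') * (y i - (∑ i', w i' * y i') / (∑ i', w i')) ^ 2

/-- **The upper bound is attained.** With two sensitive groups of size `n/2`, a binary
outcome vector `y` with group prevalences `1/2 ± ε`, sensitive kernel `K_s(i,j) = p` on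
same-group pairs, and the label-aligned confounding kernel `K_C(i,j) = q` iff `y_i = y_j`,
the kernel `K = K_s + K_C` has all row sums equal to `n(p+q)/2` and the group-free
between-group inequality attains the upper bound:
`F(A(K,y), K𝟙) = 4ε² + (q/(p+q))² (1 − 4ε²)`. -/
theorem upper_bound_attained {n : ℕ} (hn : 2 ≤ n) (heven : Even n)
    (G₁ : Finset (Fin n)) (hG₁ : G₁.card = n / 2)
    (ε : ℝ) (hε0 : 0 ≤ ε) (hε : ε ≤ 1 / 2)
    (y : Fin n → ℝ) (hy01 : ∀ i, y i = 0 ∨ y i = 1)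
    (hysum : ∑ i, y i = (n : ℝ) / 2)
    (hyG₁ : ∑ i ∈ G₁, y i = ((n : ℝ) / 2) * (1 / 2 + ε))
    (hyG₂ : ∑ i ∈ G₁ᶜ, y i = ((n : ℝ) / 2) * (1 / 2 - ε))
    (p q : ℝ) (hp : 0 < p) (hq : 0 < q)
    (K : Fin n → Fin n → ℝ)
    (hK : ∀ i j, K i j =
      (if (i ∈ G₁ ↔ j ∈ G₁) then p else 0) + (if y i = y j then q else 0)) :
    (∀ i, ∑ j, K i j = (n : ℝ) * (p + q) / 2) ∧
      wNormVar (avg K y) (fun i => ∑ j, K i j) =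
        4 * ε ^ 2 + (q / (p + q)) ^ 2 * (1 - 4 * ε ^ 2) := by
  have hn0 : (0 : ℝ) < n := by exact_mod_cast (by omega : 0 < n)
  have hpq : 0 < p + q := by linarith
  obtain ⟨s, hs⟩ : ∃ s : Fin n → ℝ, ∀ i, s i = if i ∈ G₁ then 1 else -1 := ⟨_, fun _ => rfl⟩
  have hcard : (G₁.card : ℝ) = n / 2 := by
    obtain ⟨k, hk⟩ := heven
    have h2 : G₁.card = k := by omega
    rw [h2, hk]; push_cast; ring
  have hcard2 : (G₁ᶜ.card : ℝ) = n / 2 := by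
    have h := Finset.card_add_card_compl G₁
    rw [Fintype.card_fin] at h
    have h' : (G₁.card : ℝ) + G₁ᶜ.card = n := by exact_mod_cast h
    linarith
  have hssum : ∑ i, s i = 0 := by
    rw [← Finset.sum_add_sum_compl G₁]
    have h1 : ∑ i ∈ G₁, s i = ∑ i ∈ G₁, (1 : ℝ) :=
      Finset.sum_congr rfl fun i hi => by rw [hs, if_pos hi]
    have h2 : ∑ i ∈ G₁ᶜ, s i = ∑ i ∈ G₁ᶜ, (-1 : ℝ) :=
      Finset.sum_congr rfl fun i hi => by rw [hs, if_neg (Finset.mem_compl.mp hi)]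
    rw [h1, h2, Finset.sum_const, Finset.sum_const, nsmul_eq_mul, nsmul_eq_mul, hcard, hcard2]
    ring
  have hsysum : ∑ i, s i * y i = n * ε := by
    rw [← Finset.sum_add_sum_compl G₁]
    have h1 : ∑ i ∈ G₁, s i * y i = ∑ i ∈ G₁, y i :=
      Finset.sum_congr rfl fun i hi => by rw [hs, if_pos hi, one_mul]
    have h2 : ∑ i ∈ G₁ᶜ, s i * y i = ∑ i ∈ G₁ᶜ, - y i :=
      Finset.sum_congr rfl fun i hi => by rw [hs, if_neg (Finset.mem_compl.mp hi)]; ring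
    rw [h1, h2, Finset.sum_neg_distrib, hyG₁, hyG₂]
    ring
  have hK1 : ∀ i j, K i j = (p / 2 + q / 2 - q / 2 * (2 * y i - 1)) + (p / 2 * s i) * s j
      + (q * (2 * y i - 1)) * y j := by
    intro i j
    rw [hK, hs, hs]
    rcases hy01 i with a | a <;> rcases hy01 j with b | b <;> by_cases c : i ∈ G₁ <;>
      by_cases d : j ∈ G₁ <;> simp [a, b, c, d] <;> ring
  have hK2 : ∀ i j, K i j * y j = (p / 2 + q / 2 + q / 2 * (2 * y i - 1)) * y j
      + (p / 2 * s i) * (s j * y j) := by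
    intro i j
    rw [hK1]
    rcases hy01 j with b | b <;> rw [b] <;> ring
  have hrow : ∀ i, ∑ j, K i j = (n : ℝ) * (p + q) / 2 := by
    intro i
    simp only [hK1, Finset.sum_add_distrib, ← Finset.mul_sum, hssum, hysum, Finset.sum_const,
      Finset.card_univ, Fintype.card_fin, nsmul_eq_mul]
    ring
  refine ⟨hrow, ?_⟩
  have havg : ∀ i, avg K y i = 1 / 2 - q / (2 * (p + q)) + p * ε / (p + q) * s i
      + q / (p + q) * y i := by
    intro i
    unfold avg
    rw [hrow]
    simp only [hK2, Finset.sum_add_distrib, ← Finset.mul_sum, hsysum, hysum]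
    field_simp
    ring
  have hasum : ∑ i, avg K y i = n / 2 := by
    simp only [havg, Finset.sum_add_distrib, ← Finset.mul_sum, hssum, hysum, Finset.sum_const,
      Finset.card_univ, Fintype.card_fin, nsmul_eq_mul]
    field_simp
    ring
  have hdev : ∀ i, (avg K y i - 1 / 2) ^ 2 = (p ^ 2 * ε ^ 2 + q ^ 2 / 4) / (p + q) ^ 2
      + (- (p * q * ε) / (p + q) ^ 2) * s i + (2 * p * q * ε / (p + q) ^ 2) * (s i * y i) := by
    intro i
    have hs2 : s i = 1 ∨ s i = -1 := by
      rw [hs]; split_ifs <;> simp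
    rw [havg]
    rcases hs2 with a | a <;> rcases hy01 i with b | b <;> rw [a, b] <;> field_simp <;> ring
  have hdsum : ∑ i, (avg K y i - 1 / 2) ^ 2 =
      n * ((p ^ 2 * ε ^ 2 + q ^ 2 / 4) / (p + q) ^ 2) + 2 * p * q * ε / (p + q) ^ 2 * (n * ε) := by
    simp only [hdev, Finset.sum_add_distrib, ← Finset.mul_sum, hssum, hsysum, Finset.sum_const,
      Finset.card_univ, Fintype.card_fin, nsmul_eq_mul]
    ring
  have hmean : (∑ i : Fin n, (n : ℝ) * (p + q) / 2 * avg K y i) /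
      (∑ _i : Fin n, (n : ℝ) * (p + q) / 2) = 1 / 2 := by
    rw [← Finset.mul_sum, hasum, Finset.sum_const, Finset.card_univ, Fintype.card_fin,
      nsmul_eq_mul]
    field_simp
  unfold wNormVar
  simp only [hrow]
  rw [hmean, ← Finset.mul_sum, hdsum, Finset.sum_const, Finset.card_univ, Fintype.card_fin,
      nsmul_eq_mul]
  field_simp
  ring
end

section
/- Let n ≥ 2 be even, let the population {1,…,n} be partitioned into two sensitive groups G₁ and G₂ each of size n/2, and let y ∈ {0,1}^n satisfy Σ_{i=1}^n y_i = n/2 with Σ_{i∈G₁} y_i = (n/2)(1/2+ε) and Σ_{i∈G₂} y_i = (n/2)(1/2−ε) for some ε ∈ [0,1/2]. Let p > 0, q > 0, define K_s(i,j) = p if i and j are in the same sensitive group and 0 otherwise, and let K_C be the constant matrix with every entry equal to q/2. Set K = K_s + K_C. Then every row sum of K equals n(p+q)/2, and the group-free between-group inequality attains the lower bound: F(A(K,y), K𝟙) = (p/(p+q))² · 4ε². -/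
open Finset

/-- **The lower bound is attained.** With two sensitive groups of size `n/2`, a binary
outcome vector `y` with group prevalences `1/2 ± ε`, sensitive kernel `K_s(i,j) = p` on
same-group pairs, and the constant confounding kernel `K_C(i,j) = q/2`, the kernel
`K = K_s + K_C` has all row sums equal to `n(p+q)/2` and the group-free between-group
inequality attains the lower bound: `F(A(K,y), K𝟙) = (p/(p+q))² · 4ε²`. -/
theorem lower_bound_attained {n : ℕ} (hn : 2 ≤ n) (heven : Even n)
    (G₁ : Finset (Fin n)) (hG₁ : G₁.card = n / 2)
    (ε : ℝ) (hε0 : 0 ≤ ε) (hε : ε ≤ 1 / 2)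
    (y : Fin n → ℝ) (hy01 : ∀ i, y i = 0 ∨ y i = 1)
    (hysum : ∑ i, y i = (n : ℝ) / 2)
    (hyG₁ : ∑ i ∈ G₁, y i = ((n : ℝ) / 2) * (1 / 2 + ε))
    (hyG₂ : ∑ i ∈ G₁ᶜ, y i = ((n : ℝ) / 2) * (1 / 2 - ε))
    (p q : ℝ) (hp : 0 < p) (hq : 0 < q)
    (K : Fin n → Fin n → ℝ)
    (hK : ∀ i j, K i j = (if (i ∈ G₁ ↔ j ∈ G₁) then p else 0) + q / 2) :
    (∀ i, ∑ j, K i j = (n : ℝ) * (p + q) / 2) ∧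
      wNormVar (avg K y) (fun i => ∑ j, K i j) =
        (p / (p + q)) ^ 2 * (4 * ε ^ 2) := by
  have hn0 : (0 : ℝ) < n := by exact_mod_cast (by omega : 0 < n)
  have hpq : 0 < p + q := by linarith
  have hsplit : ∀ z : Fin n → ℝ, ∑ i, z i = ∑ i ∈ G₁, z i + ∑ i ∈ G₁ᶜ, z i :=
    fun z => (Finset.sum_add_sum_compl G₁ z).symm
  have hc1 : (G₁.card : ℝ) = n / 2 := by
    obtain ⟨k, hk⟩ := heven
    have h1 : G₁.card = k := by omega
    rw [h1, hk]; push_cast; ring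
  have hc2 : (G₁ᶜ.card : ℝ) = n / 2 := by
    have h := Finset.card_add_card_compl G₁
    rw [Fintype.card_fin] at h
    have h2 : (G₁.card : ℝ) + G₁ᶜ.card = n := by exact_mod_cast h
    linarith
  have key : ∀ (z : Fin n → ℝ) (i : Fin n), ∑ j, K i j * z j =
      p * (if i ∈ G₁ then ∑ j ∈ G₁, z j else ∑ j ∈ G₁ᶜ, z j) + q / 2 * ∑ j, z j := by
    intro z i
    have e : ∀ j, K i j * z j =
        (if (i ∈ G₁ ↔ j ∈ G₁) then p else 0) * z j + q / 2 * z j := by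
      intro j; rw [hK]; ring
    rw [Finset.sum_congr rfl (fun j _ => e j), Finset.sum_add_distrib, ← Finset.mul_sum]
    congr 1
    rw [hsplit]
    by_cases hi : i ∈ G₁
    · rw [Finset.sum_congr rfl (g := fun j => p * z j) (fun j hj => by simp [hi, hj]),
        Finset.sum_eq_zero (s := G₁ᶜ) (fun j hj => by
          have hj' := Finset.mem_compl.1 hj
          simp [hi, hj'])]
      simp [hi, Finset.mul_sum]
    · rw [Finset.sum_congr (s₁ := G₁ᶜ) rfl (g := fun j => p * z j) (fun j hj => by
          have hj' := Finset.mem_compl.1 hj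
          simp [hi, hj']),
        Finset.sum_eq_zero (s := G₁) (fun j hj => by simp [hi, hj])]
      simp [hi, Finset.mul_sum]
  have hrow : ∀ i, ∑ j, K i j = (n : ℝ) * (p + q) / 2 := by
    intro i
    have h := key (fun _ => 1) i
    simp only [mul_one, Finset.sum_const, nsmul_eq_mul, hc1, hc2, ite_self,
      Finset.card_univ, Fintype.card_fin] at h
    rw [h]; ring
  refine ⟨hrow, ?_⟩
  have ha1 : ∀ i ∈ G₁, avg K y i = 1 / 2 + p / (p + q) * ε := by
    intro i hi
    simp only [avg]
    rw [key, hrow, if_pos hi, hyG₁, hysum]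
    field_simp
    ring
  have ha2 : ∀ i ∈ G₁ᶜ, avg K y i = 1 / 2 - p / (p + q) * ε := by
    intro i hi
    simp only [avg]
    rw [key, hrow, if_neg (Finset.mem_compl.1 hi), hyG₂, hysum]
    field_simp
    ring
  have hsum : ∑ i, avg K y i = (n : ℝ) / 2 := by
    rw [hsplit, Finset.sum_congr rfl ha1, Finset.sum_congr rfl ha2]
    simp only [Finset.sum_const, nsmul_eq_mul, hc1, hc2]
    ring
  have hsq : ∀ i, (avg K y i - 1 / 2) ^ 2 = (p / (p + q) * ε) ^ 2 := by
    intro i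
    by_cases hi : i ∈ G₁
    · rw [ha1 i hi]; ring
    · rw [ha2 i (Finset.mem_compl.2 hi)]; ring
  have hmean : ((n : ℝ) * (p + q) / 2 * ((n : ℝ) / 2)) / (n * (n * (p + q) / 2)) = 1 / 2 := by
    field_simp
  simp only [wNormVar, hrow, ← Finset.mul_sum, hsum, Finset.sum_const, nsmul_eq_mul,
    Finset.card_univ, Fintype.card_fin, hmean, hsq]
  field_simp
  try ring
end
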